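/- Let 𝒜 be a nonempty alphabet and X ⊆ 𝒜^ℕ a subshift. Let Ω denote the closure in X_𝔽 of {ξ_x : x ∈ X}, and for g ∈ 𝔽 let Ω_g := {ξ ∈ Ω : g ∈ ξ}. Then for every nonempty open subset U of Ω there exist a finite set B ⊆ L_X and g ∈ 𝔽 such that the set ⋂_{β∈B} Ω_{β⁻¹} is nonempty and ⋂_{β∈B} Ω_{β⁻¹} ⊆ {gξ : ξ ∈ U and g⁻¹ ∈ ξ}, where gξ := {gh : h ∈ ξ}. -/

import Mathlib

/-! Basic subshift vocabulary. -/

/-- Concatenation of a finite word with an infinite sequence. -/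
def wcat {A : Type*} (w : List A) (y : ℕ → A) : ℕ → A :=
  fun n => if h : n < w.length then w.get ⟨n, h⟩ else y (n - w.length)

/-- `w` occurs as a (finite) factor of the sequence `x`. -/
def IsFactor {A : Type*} (w : List A) (x : ℕ → A) : Prop :=
  ∃ n : ℕ, ∀ i : Fin w.length, x (n + i) = w.get i

/-- The subshift `X_F ⊆ A^ℕ` determined by a set `F` of forbidden words. -/
def subshift {A : Type*} (Forb : Set (List A)) : Set (ℕ → A) :=
  {x | ∀ w ∈ Forb, ¬ IsFactor w x}

/-- The language of a set of sequences: all finite words (including the empty word)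
occurring as factors of its elements. -/
def lang {A : Type*} (Xs : Set (ℕ → A)) : Set (List A) :=
  {w | w = [] ∨ ∃ x ∈ Xs, IsFactor w x}

/-- `C(α, β) = {βx ∈ X : αx ∈ X}`. -/
def Cab {A : Type*} (Xs : Set (ℕ → A)) (α β : List A) : Set (ℕ → A) :=
  {z | ∃ y : ℕ → A, z = wcat β y ∧ wcat β y ∈ Xs ∧ wcat α y ∈ Xs}

/-- The element of the free group on `A` determined by a word over `A`. -/
def fgw {A : Type*} (w : List A) : FreeGroup A := (w.map FreeGroup.of).prod

/-- `ξ_x = {g ∈ 𝔽 : g = βα⁻¹ for some α, β ∈ L_X with x ∈ C(α,β)}`. -/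
def xiSet {A : Type*} (Xs : Set (ℕ → A)) (x : ℕ → A) : Set (FreeGroup A) :=
  {g | ∃ α ∈ lang Xs, ∃ β ∈ lang Xs, g = fgw β * (fgw α)⁻¹ ∧ x ∈ Cab Xs α β}

/-- `α` and `β` do not end in the same letter, i.e. `αβ⁻¹` is in reduced form. -/
def NoCommonLast {A : Type*} (α β : List A) : Prop :=
  ∀ a : A, α.getLast? = some a → β.getLast? ≠ some a

open Classical in
/-- The characteristic function of `ξ_x`, viewed as a point of the product space
`{0,1}^𝔽` (with `{0,1}` discrete). -/
noncomputable def xiB {A : Type*} (Xs : Set (ℕ → A)) (x : ℕ → A) : FreeGroup A → Bool :=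
  fun g => if g ∈ xiSet Xs x then true else false

/-- `Ω`: the closure in `X_𝔽 ⊆ {0,1}^𝔽` of `{ξ_x : x ∈ X}`. -/
noncomputable def Omega {A : Type*} (Xs : Set (ℕ → A)) : Set (FreeGroup A → Bool) :=
  closure {ξ | ∃ x ∈ Xs, ξ = xiB Xs x}

section Words

variable {A : Type*}

theorem wcat_apply_of_lt {w : List A} (y : ℕ → A) {n : ℕ} (h : n < w.length) :
    wcat w y n = w[n] := by
  simp [wcat, h]

theorem wcat_apply_length_add (w : List A) (y : ℕ → A) (n : ℕ) :
    wcat w y (w.length + n) = y n := by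
  simp [wcat]

@[simp]
theorem wcat_nil (y : ℕ → A) : wcat [] y = y := by
  funext n
  simp [wcat]

theorem wcat_append (u v : List A) (y : ℕ → A) : wcat (u ++ v) y = wcat u (wcat v y) := by
  funext n
  rcases lt_or_ge n u.length with h | h
  · rw [wcat_apply_of_lt _ h, wcat_apply_of_lt _ (by simp; omega), List.getElem_append_left h]
  · obtain ⟨m, rfl⟩ := Nat.exists_eq_add_of_le h
    rw [wcat_apply_length_add]
    rcases lt_or_ge m v.length with h' | h'
    · rw [wcat_apply_of_lt _ h', wcat_apply_of_lt _ (by simp; omega)]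
      simp
    · obtain ⟨k, rfl⟩ := Nat.exists_eq_add_of_le h'
      rw [wcat_apply_length_add, ← add_assoc, ← List.length_append, wcat_apply_length_add]

/-- The prefix of length `n` of a sequence. -/
def seqTake (x : ℕ → A) (n : ℕ) : List A := List.ofFn fun i : Fin n => x i

theorem length_seqTake (x : ℕ → A) (n : ℕ) : (seqTake x n).length = n := by
  simp [seqTake]

theorem wcat_seqTake (x : ℕ → A) (n : ℕ) :
    wcat (seqTake x n) (fun i => x (n + i)) = x := by
  funext m
  rcases lt_or_ge m n with h | h
  · rw [wcat_apply_of_lt _ (by rwa [length_seqTake])]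
    simp [seqTake]
  · obtain ⟨k, rfl⟩ := Nat.exists_eq_add_of_le h
    simpa only [length_seqTake] using wcat_apply_length_add (seqTake x n) (fun i => x (n + i)) k

theorem exists_append_of_wcat_eq {u v : List A} {y z : ℕ → A} (h : wcat u y = wcat v z)
    (hl : u.length ≤ v.length) : ∃ w, v = u ++ w ∧ y = wcat w z := by
  have hu : v.take u.length = u := by
    apply List.ext_getElem (by simpa using hl)
    intro i h₁ h₂
    have := congrFun h i
    rw [wcat_apply_of_lt _ h₂, wcat_apply_of_lt _ (by omega)] at this
    simp [this]
  have hv : v = u ++ v.drop u.length := by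
    conv_lhs => rw [← List.take_append_drop u.length v, hu]
  refine ⟨v.drop u.length, hv, ?_⟩
  rw [hv, wcat_append] at h
  funext n
  simpa only [wcat_apply_length_add] using congrFun h (u.length + n)

theorem isFactor_of_wcat {w u : List A} {y : ℕ → A} (h : IsFactor w y) :
    IsFactor w (wcat u y) := by
  obtain ⟨n, hn⟩ := h
  refine ⟨u.length + n, fun i => ?_⟩
  rw [add_assoc, wcat_apply_length_add, hn]

theorem mem_subshift_of_wcat {Forb : Set (List A)} {u : List A} {y : ℕ → A}
    (h : wcat u y ∈ subshift Forb) : y ∈ subshift Forb :=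
  fun w hw hy => h w hw (isFactor_of_wcat hy)

theorem mem_lang_of_wcat {Xs : Set (ℕ → A)} {u : List A} {y : ℕ → A}
    (h : wcat u y ∈ Xs) : u ∈ lang Xs :=
  Or.inr ⟨_, h, 0, fun i => by rw [zero_add, wcat_apply_of_lt _ i.2]; rfl⟩

end Words

section FreeGroupWords

variable {A : Type*}

@[simp]
theorem fgw_nil : fgw ([] : List A) = 1 := rfl

@[simp]
theorem fgw_append (u v : List A) : fgw (u ++ v) = fgw u * fgw v := by
  simp [fgw]

theorem fgw_eq_mk (w : List A) : fgw w = FreeGroup.mk (w.map fun a => (a, true)) := by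
  induction w with
  | nil => rfl
  | cons a w ih =>
    have : fgw (a :: w) = FreeGroup.of a * fgw w := by simp [fgw]
    rw [this, ih, FreeGroup.of, FreeGroup.mul_mk]
    rfl

theorem fgw_mul_inv_eq_mk (α β : List A) :
    fgw β * (fgw α)⁻¹ = FreeGroup.mk
      (β.map (fun a => (a, true)) ++ α.reverse.map (fun a => (a, false))) := by
  rw [fgw_eq_mk, fgw_eq_mk, FreeGroup.inv_mk, FreeGroup.mul_mk]
  simp [FreeGroup.invRev, Function.comp_def]

theorem NoCommonLast.isReduced {α β : List A} (h : NoCommonLast α β) :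
    FreeGroup.IsReduced
      (β.map (fun a => (a, true)) ++ α.reverse.map (fun a => (a, false))) := by
  unfold FreeGroup.IsReduced
  rw [List.isChain_append]
  refine ⟨?_, ?_, ?_⟩
  · rw [List.isChain_map]
    exact (List.pairwise_of_forall fun _ _ _ => rfl).isChain
  · rw [List.isChain_map]
    exact (List.pairwise_of_forall fun _ _ _ => rfl).isChain
  · intro p hp q hq hpq
    simp only [List.getLast?_map, Option.mem_def, Option.map_eq_some_iff, List.head?_map,
      List.head?_reverse] at hp hq
    obtain ⟨a, ha, rfl⟩ := hp
    obtain ⟨b, hb, rfl⟩ := hq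
    simp only at hpq
    subst hpq
    exact absurd ha (h _ hb)

theorem NoCommonLast.eq_of_fgw_mul_inv_eq {α β α' β' : List A} (h : NoCommonLast α β)
    (h' : NoCommonLast α' β') (he : fgw β * (fgw α)⁻¹ = fgw β' * (fgw α')⁻¹) :
    α = α' ∧ β = β' := by
  classical
  rw [fgw_mul_inv_eq_mk, fgw_mul_inv_eq_mk] at he
  have hw := congrArg FreeGroup.toWord he
  rw [FreeGroup.toWord_mk, FreeGroup.toWord_mk, h.isReduced.reduce_eq,
    h'.isReduced.reduce_eq] at hw
  constructor
  · have := congrArg (fun l => ((l.filter fun p => !p.2).map Prod.fst).reverse) hw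
    simpa [List.filter_map, Function.comp_def] using this
  · have := congrArg (fun l => (l.filter fun p => p.2).map Prod.fst) hw
    simpa [List.filter_map, Function.comp_def] using this

/-- Every pair of words arises from one without common last letter by appending a word. -/
theorem exists_noCommonLast (α β : List A) :
    ∃ α₀ β₀ δ, NoCommonLast α₀ β₀ ∧ α = α₀ ++ δ ∧ β = β₀ ++ δ := by
  induction α using List.reverseRecOn generalizing β with
  | nil => exact ⟨[], β, [], by simp [NoCommonLast], rfl, by simp⟩
  | append_singleton α a ih =>
    by_cases h : NoCommonLast (α ++ [a]) β
    · exact ⟨_, _, [], h, by simp, by simp⟩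
    · simp only [NoCommonLast, not_forall, not_not] at h
      obtain ⟨b, hb, hβ⟩ := h
      obtain rfl : a = b := by simpa using hb
      obtain ⟨β, rfl⟩ := List.getLast?_eq_some_iff.1 hβ
      obtain ⟨α₀, β₀, δ, h₀, rfl, rfl⟩ := ih β
      exact ⟨α₀, β₀, δ ++ [a], h₀, by simp, by simp⟩

end FreeGroupWords

section XiSet

variable {A : Type*} {Xs : Set (ℕ → A)}

theorem mem_xiSet_wcat {α β : List A} {z : ℕ → A} (hβ : wcat β z ∈ Xs) (hα : wcat α z ∈ Xs) :
    fgw β * (fgw α)⁻¹ ∈ xiSet Xs (wcat β z) :=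
  ⟨α, mem_lang_of_wcat hα, β, mem_lang_of_wcat hβ, rfl, z, rfl, hβ, hα⟩

theorem NoCommonLast.mem_xiSet_iff {α β : List A} (h : NoCommonLast α β) {x : ℕ → A} :
    fgw β * (fgw α)⁻¹ ∈ xiSet Xs x ↔ x ∈ Cab Xs α β := by
  constructor
  · rintro ⟨α', -, β', -, he, z, rfl, hβ, hα⟩
    obtain ⟨α₀, β₀, δ, h₀, rfl, rfl⟩ := exists_noCommonLast α' β'
    obtain ⟨rfl, rfl⟩ := h.eq_of_fgw_mul_inv_eq h₀ (by rw [he]; simp)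
    rw [wcat_append] at hα hβ ⊢
    exact ⟨_, rfl, hβ, hα⟩
  · rintro ⟨z, rfl, hβ, hα⟩
    exact mem_xiSet_wcat hβ hα

theorem inv_fgw_mem_xiSet_iff {w : List A} {y : ℕ → A} :
    (fgw w)⁻¹ ∈ xiSet Xs y ↔ y ∈ Xs ∧ wcat w y ∈ Xs := by
  have h := NoCommonLast.mem_xiSet_iff (Xs := Xs) (x := y)
    (show NoCommonLast w [] by simp [NoCommonLast])
  rw [fgw_nil, one_mul] at h
  rw [h]
  constructor
  · rintro ⟨z, rfl, h₁, h₂⟩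
    simpa using And.intro h₁ h₂
  · rintro ⟨h₁, h₂⟩
    exact ⟨y, by simp, by simpa using h₁, h₂⟩

theorem one_mem_xiSet {x : ℕ → A} (hx : x ∈ Xs) : (1 : FreeGroup A) ∈ xiSet Xs x := by
  simpa using (inv_fgw_mem_xiSet_iff (Xs := Xs) (w := []) (y := x)).2 (by simpa using hx)

variable {Forb : Set (List A)}

/-- The partial action of a word on points: prepending `w` to `y` translates `ξ_y` by `w`. -/
theorem inv_fgw_mul_mem_xiSet_iff {w : List A} {y : ℕ → A} (hw : wcat w y ∈ subshift Forb)
    {g : FreeGroup A} :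
    (fgw w)⁻¹ * g ∈ xiSet (subshift Forb) y ↔ g ∈ xiSet (subshift Forb) (wcat w y) := by
  constructor
  · rintro ⟨α, -, β, -, he, z, rfl, -, hα⟩
    rw [← wcat_append] at hw ⊢
    obtain rfl : g = fgw (w ++ β) * (fgw α)⁻¹ := by
      rw [fgw_append, mul_assoc, ← he, mul_inv_cancel_left]
    exact mem_xiSet_wcat hw hα
  · rintro ⟨α, -, β, -, rfl, z, he, -, hα⟩
    have hy := mem_subshift_of_wcat hw
    rcases le_total w.length β.length with hl | hl
    · obtain ⟨δ, rfl, rfl⟩ := exists_append_of_wcat_eq he hl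
      rw [fgw_append, mul_assoc, inv_mul_cancel_left]
      exact mem_xiSet_wcat hy hα
    · obtain ⟨δ, rfl, rfl⟩ := exists_append_of_wcat_eq he.symm hl
      rw [← wcat_append] at hα
      convert inv_fgw_mem_xiSet_iff.2 ⟨hy, hα⟩ using 1
      simp [mul_assoc]

/-- For fixed `p`, the condition `p ∉ ξ_x` only depends on a finite prefix of `x ∈ X`. -/
theorem exists_forall_notMem_xiSet {x : ℕ → A} (hx : x ∈ subshift Forb) {p : FreeGroup A}
    (hp : p ∉ xiSet (subshift Forb) x) :
    ∃ N, ∀ x' : ℕ → A, (∀ i < N, x' i = x i) → p ∉ xiSet (subshift Forb) x' := by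
  by_cases hrep : ∃ α β : List A, p = fgw β * (fgw α)⁻¹
  · obtain ⟨α', β', rfl⟩ := hrep
    obtain ⟨α, β, δ, h, rfl, rfl⟩ := exists_noCommonLast α' β'
    have he : fgw (β ++ δ) * (fgw (α ++ δ))⁻¹ = fgw β * (fgw α)⁻¹ := by simp
    simp only [he, h.mem_xiSet_iff] at hp ⊢
    by_cases hz : ∃ z, x = wcat β z
    · obtain ⟨z, rfl⟩ := hz
      have hα : wcat α z ∉ subshift Forb := fun hα => hp ⟨z, rfl, hx, hα⟩
      simp only [subshift, Set.mem_ofPred_eq, not_forall, not_not] at hα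
      obtain ⟨u, hu, m, hm⟩ := hα
      refine ⟨β.length + (m + u.length), ?_⟩
      rintro _ hx' ⟨z', rfl, -, hα'⟩
      refine hα' u hu ⟨m, fun i => ?_⟩
      rw [← hm i]
      rcases lt_or_ge (m + i : ℕ) α.length with hi | hi
      · rw [wcat_apply_of_lt _ hi, wcat_apply_of_lt _ hi]
      · obtain ⟨k, hk⟩ := Nat.exists_eq_add_of_le hi
        have := hx' (β.length + k) (by have := i.2; omega)
        rw [wcat_apply_length_add, wcat_apply_length_add] at this
        rw [hk, wcat_apply_length_add, wcat_apply_length_add, this]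
    · refine ⟨β.length, ?_⟩
      rintro _ hx' ⟨z', rfl, -, -⟩
      refine hz ⟨fun i => x (β.length + i), funext fun n => ?_⟩
      rcases lt_or_ge n β.length with hn | hn
      · rw [← hx' n hn, wcat_apply_of_lt _ hn, wcat_apply_of_lt _ hn]
      · obtain ⟨k, rfl⟩ := Nat.exists_eq_add_of_le hn
        rw [wcat_apply_length_add]
  · refine ⟨0, fun x' _ hp' => hrep ?_⟩
    obtain ⟨α, -, β, -, he, -⟩ := hp'
    exact ⟨α, β, he⟩

/-- Membership of `p` in `ξ_x` is, for points sharing a long prefix `γ` with `x = γy`, forced by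
membership of a single inverse word in `ξ_y`. -/
theorem exists_word_forcing {x : ℕ → A} (hx : x ∈ subshift Forb) (p : FreeGroup A) :
    ∃ N, ∀ n ≥ N, ∃ w, wcat w (fun i => x (n + i)) ∈ subshift Forb ∧
      ∀ y', wcat (seqTake x n) y' ∈ subshift Forb → wcat w y' ∈ subshift Forb →
        (p ∈ xiSet (subshift Forb) (wcat (seqTake x n) y') ↔ p ∈ xiSet (subshift Forb) x) := by
  by_cases hp : p ∈ xiSet (subshift Forb) x
  · obtain ⟨α, -, β, -, rfl, z, hz, -, hα⟩ := id hp
    refine ⟨β.length, fun n hn => ?_⟩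
    obtain ⟨δ, hδ, rfl⟩ := exists_append_of_wcat_eq (hz.symm.trans (wcat_seqTake x n).symm)
      (by rwa [length_seqTake])
    refine ⟨α ++ δ, by rwa [wcat_append], fun y' h₁ h₂ => iff_of_true ?_ hp⟩
    rw [hδ, wcat_append] at h₁ ⊢
    rw [wcat_append] at h₂
    exact mem_xiSet_wcat h₁ h₂
  · obtain ⟨N, hN⟩ := exists_forall_notMem_xiSet hx hp
    refine ⟨N, fun n hn => ⟨seqTake x n, by rwa [wcat_seqTake], fun y' _ _ =>
      iff_of_false (hN _ fun i hi => ?_) hp⟩⟩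
    have hi' : i < (seqTake x n).length := by rw [length_seqTake]; omega
    rw [wcat_apply_of_lt _ hi']
    simp [seqTake]

theorem xiB_eq_true_iff {x : ℕ → A} {g : FreeGroup A} : xiB Xs x g = true ↔ g ∈ xiSet Xs x := by
  simp [xiB]

theorem xiB_mem_Omega {x : ℕ → A} (hx : x ∈ Xs) : xiB Xs x ∈ Omega Xs :=
  subset_closure ⟨x, hx, rfl⟩

theorem apply_one_of_mem_Omega {η : FreeGroup A → Bool} (h : η ∈ Omega Xs) : η 1 = true := by
  have hc : IsClosed {η : FreeGroup A → Bool | η 1 = true} :=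
    isClosed_eq (continuous_apply 1) continuous_const
  refine closure_minimal ?_ hc h
  rintro _ ⟨x, hx, rfl⟩
  exact xiB_eq_true_iff.2 (one_mem_xiSet hx)

end XiSet

/-- Lemma 5.14 (orbit): for every nonempty (relatively) open subset `U` of `Ω` there exist
a finite set `B ⊆ L_X` and `g ∈ 𝔽` such that `⋂_{β ∈ B} Ω_{β⁻¹}` is nonempty and contained
in `θ̂_g(U ∩ Ω_{g⁻¹}) = {gξ : ξ ∈ U, g⁻¹ ∈ ξ}`. -/
theorem stmt_14 {A : Type*} [Nonempty A] (Forb : Set (List A)) (U : Set (FreeGroup A → Bool))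
    (hUsub : U ⊆ Omega (subshift Forb))
    (hUopen : ∃ V : Set (FreeGroup A → Bool), IsOpen V ∧ U = V ∩ Omega (subshift Forb))
    (hUne : U.Nonempty) :
    ∃ (Bf : Finset (List A)) (g : FreeGroup A),
      (∀ β ∈ Bf, β ∈ lang (subshift Forb)) ∧
      {ξ : FreeGroup A → Bool |
          ξ ∈ Omega (subshift Forb) ∧ ∀ β ∈ Bf, ξ (fgw β)⁻¹ = true}.Nonempty ∧
      {ξ : FreeGroup A → Bool |
          ξ ∈ Omega (subshift Forb) ∧ ∀ β ∈ Bf, ξ (fgw β)⁻¹ = true} ⊆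
        {η : FreeGroup A → Bool |
          ∃ ξ ∈ U, ξ g⁻¹ = true ∧ η = fun h => ξ (g⁻¹ * h)} := by
  classical
  obtain ⟨V, hV, rfl⟩ := hUopen
  obtain ⟨ξ₀, hξ₀V, hξ₀⟩ := hUne
  obtain ⟨_, hxV, x, hx, rfl⟩ := mem_closure_iff.1 hξ₀ V hV hξ₀V
  obtain ⟨S, u, hu, hSV⟩ := isOpen_pi_iff.1 hV _ hxV
  choose N hN using exists_word_forcing hx
  set n := S.sup N
  set γ := seqTake x n
  choose! w hw hforce using fun p (hp : p ∈ S) => hN p n (Finset.le_sup hp)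
  have hγ : wcat γ (fun i => x (n + i)) ∈ subshift Forb := by rwa [wcat_seqTake]
  have hy := mem_subshift_of_wcat hγ
  have hB : ∀ β ∈ insert γ (S.image w), wcat β (fun i => x (n + i)) ∈ subshift Forb := by
    intro β hβ
    rcases Finset.mem_insert.1 hβ with rfl | hβ
    · exact hγ
    · obtain ⟨p, hp, rfl⟩ := Finset.mem_image.1 hβ
      exact hw p hp
  refine ⟨insert γ (S.image w), (fgw γ)⁻¹, fun β hβ => mem_lang_of_wcat (hB β hβ),
    ⟨_, xiB_mem_Omega hy, fun β hβ =>
      xiB_eq_true_iff.2 (inv_fgw_mem_xiSet_iff.2 ⟨hy, hB β hβ⟩)⟩, ?_⟩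
  rintro η ⟨hη, hηB⟩
  let T : (FreeGroup A → Bool) → FreeGroup A → Bool := fun ζ h => ζ ((fgw γ)⁻¹ * h)
  have hT : Continuous T := continuous_pi fun h => continuous_apply _
  let W : Set (FreeGroup A → Bool) := {ζ | ∀ β ∈ insert γ (S.image w), ζ (fgw β)⁻¹ = true}
  have hW : IsOpen W := by
    have : W = ⋂ β ∈ insert γ (S.image w), {ζ | ζ (fgw β)⁻¹ = true} := by
      ext ζ
      simp [W]
    rw [this]
    exact isOpen_biInter_finset fun β _ =>
      (isOpen_discrete ({true} : Set Bool)).preimage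
        (continuous_apply (A := fun _ : FreeGroup A => Bool) (fgw β)⁻¹)
  have hK : IsClosed {ζ : FreeGroup A → Bool | ∀ p ∈ S, ζ p = xiB (subshift Forb) x p} := by
    simp only [Set.ofPred_forall]
    exact isClosed_biInter fun p _ => isClosed_eq (continuous_apply p) continuous_const
  have hmaps : Set.MapsTo T (W ∩ {ξ | ∃ y ∈ subshift Forb, ξ = xiB (subshift Forb) y})
      ({ζ | ∀ p ∈ S, ζ p = xiB (subshift Forb) x p} ∩
        {ξ | ∃ y ∈ subshift Forb, ξ = xiB (subshift Forb) y}) := by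
    rintro _ ⟨hζ, y', hy', rfl⟩
    have hcat : ∀ β ∈ insert γ (S.image w), wcat β y' ∈ subshift Forb := fun β hβ =>
      (inv_fgw_mem_xiSet_iff.1 (xiB_eq_true_iff.1 (hζ β hβ))).2
    have hγy' := hcat γ (Finset.mem_insert_self _ _)
    have hTy' : T (xiB (subshift Forb) y') = xiB (subshift Forb) (wcat γ y') := by
      funext h
      rw [Bool.eq_iff_iff]
      simp only [T, xiB_eq_true_iff, inv_fgw_mul_mem_xiSet_iff hγy']
    rw [hTy']
    refine ⟨fun p hp => ?_, _, hγy', rfl⟩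
    rw [Bool.eq_iff_iff, xiB_eq_true_iff, xiB_eq_true_iff]
    exact hforce p hp y' hγy'
      (hcat _ (Finset.mem_insert_of_mem (Finset.mem_image_of_mem w hp)))
  have hTη := map_mem_closure hT (hW.inter_closure ⟨hηB, hη⟩) hmaps
  have hTK := closure_minimal Set.inter_subset_left hK hTη
  refine ⟨T η, ⟨hSV fun p hp => ?_, closure_mono Set.inter_subset_right hTη⟩, ?_, ?_⟩
  · rw [hTK p hp]
    exact (hu p hp).2
  · simpa [T] using apply_one_of_mem_Omega hη
  · funext h
    simp [T]
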